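/- Let i, j be positive integers with i < j and gcd(i, j) = 1, and let M = {i, j, i + j, i + 2j}. If i + 3j ≡ r (mod 4) with r = 1 or r = 3, then μ(M) ≥ (i + 3j − r)/(4(i + 3j)). -/

import Mathlib

open Filter Set Pointwise

/-- `countBelow S x` is the number of elements `n ∈ S` with `n ≤ x`. -/
noncomputable def countBelow (S : Set ℕ) (x : ℕ) : ℕ := (S ∩ Set.Iic x).ncard

/-- The upper asymptotic density `δ̄(S) = limsup_{x→∞} S(x)/x` of a set `S ⊆ ℕ`. -/
noncomputable def upperDensity (S : Set ℕ) : ℝ :=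
  Filter.limsup (fun x : ℕ => (countBelow S x : ℝ) / x) Filter.atTop

/-- `S` is an `M`-set: for all `a, b ∈ S`, the difference `a - b` does not lie in `M`. -/
def IsMSet (M S : Set ℕ) : Prop := ∀ a ∈ S, ∀ b ∈ S, a - b ∉ M

/-- Motzkin's quantity `μ(M)`: the supremum of the upper densities of all `M`-sets. -/
noncomputable def muM (M : Set ℕ) : ℝ :=
  sSup {x : ℝ | ∃ S : Set ℕ, IsMSet M S ∧ x = upperDensity S}

lemma countBelow_le (S : Set ℕ) (x : ℕ) : countBelow S x ≤ x + 1 := by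
  have h : (S ∩ Set.Iic x).ncard ≤ (Set.Iic x).ncard :=
    Set.ncard_le_ncard Set.inter_subset_right (Set.finite_Iic x)
  rw [← Finset.coe_Iic, Set.ncard_coe_finset, Nat.card_Iic, Finset.coe_Iic] at h
  exact h

lemma countBelow_div_le_two (S : Set ℕ) (x : ℕ) : (countBelow S x : ℝ) / x ≤ 2 := by
  rcases Nat.eq_zero_or_pos x with rfl | hx
  · simp
  · have hx' : (1 : ℝ) ≤ x := by exact_mod_cast hx
    have h : (countBelow S x : ℝ) ≤ x + 1 := by exact_mod_cast countBelow_le S x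
    rw [div_le_iff₀ (by linarith)]
    linarith

lemma upperDensity_le_two (S : Set ℕ) : upperDensity S ≤ 2 :=
  Filter.limsup_le_of_le
    (Filter.isCoboundedUnder_le_of_le Filter.atTop (x := 0) fun _ => by positivity)
    (Filter.Eventually.of_forall (countBelow_div_le_two S))

lemma upperDensity_le_muM {M S : Set ℕ} (hS : IsMSet M S) : upperDensity S ≤ muM M := by
  refine le_csSup ⟨2, ?_⟩ ⟨S, hS, rfl⟩
  rintro _ ⟨T, -, rfl⟩
  exact upperDensity_le_two T

/-- A set having at least `q * N` elements up to `m * N` for every `N` has upper density at least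
`q / m`. -/
lemma div_le_upperDensity {S : Set ℕ} {m q : ℕ} (hm : 0 < m)
    (h : ∀ N, q * N ≤ countBelow S (m * N)) : (q : ℝ) / m ≤ upperDensity S := by
  refine Filter.le_limsup_of_frequently_le ?_
    (Filter.isBoundedUnder_of ⟨2, countBelow_div_le_two S⟩)
  rw [Filter.frequently_atTop]
  intro a
  refine ⟨m * (a + 1), by nlinarith, ?_⟩
  have hm' : (0 : ℝ) < m := by exact_mod_cast hm
  have h' : (q : ℝ) * (a + 1) ≤ countBelow S (m * (a + 1)) := by exact_mod_cast h (a + 1)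
  push_cast
  rw [div_le_div_iff₀ hm' (by positivity)]
  nlinarith

/-- The integers congruent modulo `m` to one of `0, 4j, 8j, …, 4(q - 1)j`. -/
def fourStepSet (m j q : ℕ) : Set ℕ := {n | ∃ k < q, n ≡ 4 * k * j [MOD m]}

lemma mul_le_countBelow_fourStepSet {m j q : ℕ} (hm : 0 < m) (hcop : Nat.Coprime m j)
    (hq : 4 * q ≤ m) (N : ℕ) : q * N ≤ countBelow (fourStepSet m j q) (m * N) := by
  let f : ℕ × ℕ → ℕ := fun p => 4 * p.1 * j % m + m * p.2
  have hinj : Set.InjOn f (Finset.range q ×ˢ Finset.range N : Finset (ℕ × ℕ)) := by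
    rintro ⟨k, n⟩ hp ⟨l, n'⟩ hp' heq
    simp only [Finset.coe_product, Finset.coe_range, Set.mem_prod, Set.mem_Iio] at hp hp'
    simp only [f] at heq
    have hmod : 4 * k * j ≡ 4 * l * j [MOD m] := by
      have := congrArg (· % m) heq
      simpa [Nat.ModEq] using this
    have hkl : 4 * k = 4 * l :=
      (Nat.ModEq.cancel_right_of_coprime hcop hmod).eq_of_lt_of_lt (by omega) (by omega)
    rw [hkl] at heq
    have hn : n = n' := Nat.eq_of_mul_eq_mul_left hm (Nat.add_left_cancel heq)
    ext
    · simp only; omega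
    · exact hn
  have hsub : ((Finset.range q ×ˢ Finset.range N).image f : Set ℕ) ⊆
      fourStepSet m j q ∩ Set.Iic (m * N) := by
    intro x hx
    simp only [Finset.coe_image, Set.mem_image, Finset.mem_coe, Finset.mem_product,
      Finset.mem_range, Prod.exists] at hx
    obtain ⟨k, n, ⟨hk, hn⟩, rfl⟩ := hx
    refine ⟨⟨k, hk, by simp [f, Nat.ModEq]⟩, ?_⟩
    have := Nat.mod_lt (4 * k * j) hm
    simp only [f, Set.mem_Iic]
    nlinarith
  have h := Set.ncard_le_ncard hsub ((Set.finite_Iic _).inter_of_right _)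
  rwa [Set.ncard_coe_finset, Finset.card_image_of_injOn hinj, Finset.card_product,
    Finset.card_range, Finset.card_range] at h

lemma isMSet_fourStepSet {i j q : ℕ} (hi : 0 < i) (hj : 0 < j)
    (hcop : Nat.Coprime (i + 3 * j) j) (hq : 4 * q ≤ i + 3 * j) :
    IsMSet {i, j, i + j, i + 2 * j} (fourStepSet (i + 3 * j) j q) := by
  rintro a ⟨k, hk, ha⟩ b ⟨l, hl, hb⟩ hab
  obtain ⟨c, hc, t, hd, hd'⟩ : ∃ c : ℤ, (c = 1 ∨ c = -1 ∨ c = -2 ∨ c = -3) ∧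
      ∃ t : ℤ, (a : ℤ) - b = c * j + ((i + 3 * j : ℕ) : ℤ) * t ∧ b < a := by
    simp only [Set.mem_insert_iff, Set.mem_singleton_iff] at hab
    rcases hab with h | h | h | h
    · exact ⟨-3, by simp, 1, by push_cast; omega, by omega⟩
    · exact ⟨1, by simp, 0, by push_cast; omega, by omega⟩
    · exact ⟨-2, by simp, 1, by push_cast; omega, by omega⟩
    · exact ⟨-1, by simp, 1, by push_cast; omega, by omega⟩
  obtain ⟨u, hu⟩ := Nat.modEq_iff_dvd.mp ha
  obtain ⟨v, hv⟩ := Nat.modEq_iff_dvd.mp hb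
  have hdvd : ((i + 3 * j : ℕ) : ℤ) ∣ (4 * (k - l) - c) * j := by
    refine ⟨t + u - v, ?_⟩
    push_cast at hu hv hd ⊢
    linear_combination hd + hu - hv
  have hdvd' : ((i + 3 * j : ℕ) : ℤ) ∣ 4 * (k - l) - c :=
    (Nat.isCoprime_iff_coprime.mpr hcop).dvd_of_dvd_mul_right hdvd
  have hzero : 4 * ((k : ℤ) - l) - c = 0 :=
    Int.eq_zero_of_abs_lt_dvd hdvd' (by rw [abs_lt]; omega)
  omega

/-- Corollary 2 (inequality cases): For `M = {i, j, i+j, i+2j}` with `i < j`,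
`gcd(i,j) = 1`, if `i + 3j ≡ r (mod 4)` with `r = 1` or `r = 3`, then
`μ(M) ≥ (i + 3j - r)/(4(i + 3j))`. -/
theorem stmt9 (i j : ℕ) (hi : 0 < i) (hij : i < j) (hgcd : Nat.gcd i j = 1)
    (M : Set ℕ) (hM : M = {i, j, i + j, i + 2 * j})
    (r : ℕ) (hr : r = 1 ∨ r = 3) (hres : (i + 3 * j) % 4 = r) :
    ((i : ℝ) + 3 * j - r) / (4 * ((i : ℝ) + 3 * j)) ≤ muM M := by
  subst hM
  have hcop : Nat.Coprime (i + 3 * j) j := by simpa [Nat.Coprime] using hgcd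
  have hm : 0 < i + 3 * j := by omega
  obtain ⟨q, hq⟩ : ∃ q, i + 3 * j = 4 * q + r := ⟨(i + 3 * j) / 4, by omega⟩
  have hS := isMSet_fourStepSet hi (by omega : 0 < j) hcop (by omega : 4 * q ≤ i + 3 * j)
  refine le_trans (le_of_eq ?_) ((div_le_upperDensity hm
    (mul_le_countBelow_fourStepSet hm hcop (by omega : 4 * q ≤ i + 3 * j))).trans
      (upperDensity_le_muM hS))
  have hq' : (i : ℝ) + 3 * j = 4 * q + r := by exact_mod_cast hq
  have hm' : (0 : ℝ) < 4 * q + r := by rw [← hq']; exact_mod_cast hm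
  push_cast
  rw [hq']
  field_simp
  ring
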